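/- Let g_0, g_1 : ℝ → SE(2) be curves with velocities ξ̂_0, ξ̂_1 : ℝ → se(2), and let ḡ_{01} ∈ SE(2) be constant. Define g_{a_1}(t) = g_0(t) ḡ_{01}, ξ̂_{a_1}(t) = Ad_{ḡ_{01}⁻¹} ξ̂_0(t), and g_{01}(t) = g_0(t)⁻¹ g_1(t). Assume the translation vector of g_1(t) is bounded on [0, ∞). If, as t → ∞, g_{a_1}(t)⁻¹ g_1(t) → I and Ad_{g_1(t)} ξ̂_1(t) − Ad_{g_{a_1}(t)} ξ̂_{a_1}(t) → 0, then g_{01}(t) → ḡ_{01} and ξ̂_1(t) − Ad_{g_{01}(t)⁻¹} ξ̂_0(t) → 0 as t → ∞. That is, if the follower tracks the transformed system, then the follower achieves the formation ḡ_{01} with respect to the leader. -/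

import Mathlib

open Matrix Filter Real

/-- The SE(2) element with rotation angle `θ` and translation vector `(x, y)`. -/
noncomputable def SE2mat (θ x y : ℝ) : Matrix (Fin 3) (Fin 3) ℝ :=
  !![Real.cos θ, -Real.sin θ, x; Real.sin θ, Real.cos θ, y; 0, 0, 1]

/-- The se(2) element with vector form `(ω, v_x, v_y)`. -/
def se2mat (ω vx vy : ℝ) : Matrix (Fin 3) (Fin 3) ℝ :=
  !![0, -ω, vx; ω, 0, vy; 0, 0, 0]

/-- Membership in SE(2). -/
def IsSE2 (g : Matrix (Fin 3) (Fin 3) ℝ) : Prop := ∃ θ x y : ℝ, g = SE2mat θ x y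

/-- Membership in se(2). -/
def Isse2 (ξ : Matrix (Fin 3) (Fin 3) ℝ) : Prop := ∃ ω vx vy : ℝ, ξ = se2mat ω vx vy

/-- The adjoint map `Ad_g X = g X g⁻¹`. -/
noncomputable def Adj (g X : Matrix (Fin 3) (Fin 3) ℝ) : Matrix (Fin 3) (Fin 3) ℝ :=
  g * X * g⁻¹

/-- The matrix commutator `[X, Y] = X Y − Y X`. -/
def matComm (X Y : Matrix (Fin 3) (Fin 3) ℝ) : Matrix (Fin 3) (Fin 3) ℝ := X * Y - Y * X

lemma SE2mat_mul_SE2mat (θ x y φ u v : ℝ) :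
    SE2mat θ x y * SE2mat φ u v =
      SE2mat (θ + φ) (cos θ * u - sin θ * v + x) (sin θ * u + cos θ * v + y) := by
  ext i j
  fin_cases i <;> fin_cases j <;>
    simp [SE2mat, Matrix.mul_apply, Fin.sum_univ_three, Real.cos_add, Real.sin_add] <;> ring

lemma SE2mat_zero : SE2mat 0 0 0 = 1 := by
  ext i j
  fin_cases i <;> fin_cases j <;> simp [SE2mat]

lemma SE2mat_mul_neg (θ x y : ℝ) :
    SE2mat θ x y * SE2mat (-θ) (-(cos θ * x + sin θ * y)) (sin θ * x - cos θ * y) = 1 := by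
  rw [SE2mat_mul_SE2mat, ← SE2mat_zero]
  congr 1
  · ring
  · linear_combination -x * Real.sin_sq_add_cos_sq θ
  · linear_combination -y * Real.sin_sq_add_cos_sq θ

lemma SE2mat_inv (θ x y : ℝ) :
    (SE2mat θ x y)⁻¹ =
      SE2mat (-θ) (-(cos θ * x + sin θ * y)) (sin θ * x - cos θ * y) :=
  Matrix.inv_eq_right_inv (SE2mat_mul_neg θ x y)

lemma IsSE2.isUnit_det {g : Matrix (Fin 3) (Fin 3) ℝ} (hg : IsSE2 g) : IsUnit g.det := by
  obtain ⟨θ, x, y, rfl⟩ := hg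
  exact Matrix.isUnit_det_of_right_inverse (SE2mat_mul_neg θ x y)

lemma abs_SE2mat_apply_le (θ x y : ℝ) (i j : Fin 3) :
    |SE2mat θ x y i j| ≤ 1 + |x| + |y| := by
  have hc := Real.abs_cos_le_one θ
  have hs := Real.abs_sin_le_one θ
  have hx := abs_nonneg x
  have hy := abs_nonneg y
  fin_cases i <;> fin_cases j <;> simp [SE2mat] <;> linarith

lemma abs_SE2mat_inv_apply_le (θ x y : ℝ) (i j : Fin 3) :
    |(SE2mat θ x y)⁻¹ i j| ≤ 1 + 2 * |x| + 2 * |y| := by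
  have mul_le {a : ℝ} (ha : |a| ≤ 1) (b : ℝ) : |a * b| ≤ |b| := by
    rw [abs_mul]
    exact mul_le_of_le_one_left (abs_nonneg b) ha
  have h := abs_SE2mat_apply_le (-θ) (-(cos θ * x + sin θ * y)) (sin θ * x - cos θ * y) i j
  rw [← SE2mat_inv, abs_neg] at h
  linarith [abs_add_le (cos θ * x) (sin θ * y), abs_sub (sin θ * x) (cos θ * y),
    mul_le (Real.abs_cos_le_one θ) x, mul_le (Real.abs_sin_le_one θ) x,
    mul_le (Real.abs_cos_le_one θ) y, mul_le (Real.abs_sin_le_one θ) y]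

/-- Multiplying on both sides by entrywise bounded matrices preserves convergence to zero. -/
lemma tendsto_mul_mul_zero_of_bounded {α : Type*} {l : Filter α} {n : Type*} [Fintype n]
    {A D B : α → Matrix n n ℝ} {a b : ℝ}
    (hA : ∀ᶠ t in l, ∀ i j, |A t i j| ≤ a) (hB : ∀ᶠ t in l, ∀ i j, |B t i j| ≤ b)
    (hD : Tendsto D l (nhds 0)) : Tendsto (fun t => A t * D t * B t) l (nhds 0) := by
  have hA' (i j : n) : IsBoundedUnder (· ≤ ·) l (norm ∘ fun t => A t i j) :=
    ⟨a, eventually_map.2 (hA.mono fun t ht => ht i j)⟩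
  have hB' (i j : n) : IsBoundedUnder (· ≤ ·) l (norm ∘ fun t => B t i j) :=
    ⟨b, eventually_map.2 (hB.mono fun t ht => ht i j)⟩
  have hD' (i j : n) : Tendsto (fun t => D t i j) l (nhds 0) :=
    tendsto_pi_nhds.1 (tendsto_pi_nhds.1 hD i) j
  refine tendsto_pi_nhds.2 fun i => tendsto_pi_nhds.2 fun j => ?_
  simp only [Matrix.mul_apply, Matrix.zero_apply]
  rw [← Finset.sum_const_zero (s := (Finset.univ : Finset n))]
  refine tendsto_finsetSum _ fun k _ => Tendsto.zero_mul_isBoundedUnder_le ?_ (hB' k j)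
  rw [← Finset.sum_const_zero (s := (Finset.univ : Finset n))]
  exact tendsto_finsetSum _ fun m _ => isBoundedUnder_le_mul_tendsto_zero (hA' i m) (hD' m k)

/-- if the follower tracks the transformed system `g_{a₁} = g₀ ḡ₀₁`,
`ξ̂_{a₁} = Ad_{ḡ₀₁⁻¹} ξ̂₀`, then the follower achieves the formation `ḡ₀₁` with respect
to the leader. -/
theorem formation_from_tracking_transformed_system
    (g0 g1 ξ0 ξ1 : ℝ → Matrix (Fin 3) (Fin 3) ℝ) (gbar : Matrix (Fin 3) (Fin 3) ℝ)
    (hg0 : ∀ t : ℝ, IsSE2 (g0 t)) (hg1 : ∀ t : ℝ, IsSE2 (g1 t)) (hgbar : IsSE2 gbar)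
    (hξ0 : ∀ t : ℝ, Isse2 (ξ0 t)) (hξ1 : ∀ t : ℝ, Isse2 (ξ1 t))
    (hbound : ∃ C : ℝ, ∀ t : ℝ, 0 ≤ t → |g1 t 0 2| ≤ C ∧ |g1 t 1 2| ≤ C)
    (htrack : Filter.Tendsto (fun t => (g0 t * gbar)⁻¹ * g1 t) Filter.atTop (nhds 1))
    (hvel : Filter.Tendsto
      (fun t => Adj (g1 t) (ξ1 t) - Adj (g0 t * gbar) (Adj gbar⁻¹ (ξ0 t)))
      Filter.atTop (nhds 0)) :
    Filter.Tendsto (fun t => (g0 t)⁻¹ * g1 t) Filter.atTop (nhds gbar) ∧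
      Filter.Tendsto (fun t => ξ1 t - Adj ((g0 t)⁻¹ * g1 t)⁻¹ (ξ0 t))
        Filter.atTop (nhds 0) := by
  have hbar := hgbar.isUnit_det
  constructor
  · have h := htrack.const_mul gbar
    rw [mul_one] at h
    refine h.congr fun t => ?_
    rw [Matrix.mul_inv_rev, ← mul_assoc, Matrix.mul_nonsing_inv_cancel_left _ _ hbar]
  · obtain ⟨C, hC⟩ := hbound
    have hentry (t : ℝ) (ht : 0 ≤ t) (i j : Fin 3) :
        |(g1 t)⁻¹ i j| ≤ 1 + 2 * C + 2 * C ∧ |g1 t i j| ≤ 1 + C + C := by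
      have hb := hC t ht
      obtain ⟨θ, x, y, hg⟩ := hg1 t
      rw [hg] at hb ⊢
      have hx : |x| ≤ C := hb.1
      have hy : |y| ≤ C := hb.2
      exact ⟨(abs_SE2mat_inv_apply_le θ x y i j).trans (by linarith),
        (abs_SE2mat_apply_le θ x y i j).trans (by linarith)⟩
    have h := tendsto_mul_mul_zero_of_bounded
      ((eventually_ge_atTop 0).mono fun t ht i j => (hentry t ht i j).1)
      ((eventually_ge_atTop 0).mono fun t ht i j => (hentry t ht i j).2) hvel
    refine h.congr fun t => ?_
    have h0 := (hg0 t).isUnit_det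
    have h1 := (hg1 t).isUnit_det
    have hinv : IsUnit (gbar⁻¹).det := Matrix.isUnit_nonsing_inv_det _ hbar
    simp only [Adj, Matrix.mul_inv_rev, Matrix.nonsing_inv_nonsing_inv _ h0,
      Matrix.nonsing_inv_nonsing_inv _ h1, Matrix.nonsing_inv_nonsing_inv _ hbar,
      mul_sub, sub_mul, mul_assoc, Matrix.mul_nonsing_inv_cancel_left _ _ hbar,
      Matrix.nonsing_inv_mul_cancel_left _ _ h1, Matrix.nonsing_inv_mul _ h1, mul_one]
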